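/- Theorem C.1, (1)⇔(3): A dataset {p^N}_{N∈𝒩} is consistent with GLM* (the general linear-in-means model allowing π_i^N(i) ≥ 0) if and only if it satisfies no ext incentive compatible money pump, i.e. for every agent i ∈ 𝒜 there is no family (b^N)_{N∈𝒩_i^{ext}} of vectors in ℝ^X such that (a) Σ_{N∈𝒩_i^{ext}} b^N has all coordinates strictly negative, (b) b^N · p_i^N > 0 for every N ∈ 𝒩_i^{ext}, and (c) b^N · (p_i^N − p_j^N) ≥ 0 for every N ∈ 𝒩_i^{ext} and every j ∈ N∖{i}. -/

import Mathlib

open Finset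
open scoped Classical

noncomputable section

/-- The simplex Δ(X) of probability vectors on a finite set X. -/
def simplex (X : Type*) [Fintype X] : Set (X → ℝ) :=
  {v | (∀ x, 0 ≤ v x) ∧ (∑ x, v x) = 1}

/-- Consistency with GLM*: the general linear-in-means model allowing π_i^N(i) ≥ 0. -/
def GLMStarConsistent {X A : Type*} [Fintype X] [DecidableEq A]
    (𝒩 : Finset (Finset A)) (p : Finset A → A → X → ℝ) : Prop :=
  ∃ v : A → X → ℝ, (∀ i, v i ∈ simplex X) ∧
    ∀ N ∈ 𝒩, ∀ i ∈ N, ∃ π : A → ℝ,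
      (∀ j ∈ N, 0 ≤ π j) ∧ (∑ j ∈ N, π j) = 1 ∧
      p N i = π i • v i + ∑ j ∈ N.erase i, π j • p N j

/-- 𝒩_i^{ext}: the groups containing i in which agent i's choice is not in the convex
hull of the other agents' choices. -/
def Next {X A : Type*} [Fintype X] [DecidableEq A]
    (𝒩 : Finset (Finset A)) (p : Finset A → A → X → ℝ) (i : A) : Finset (Finset A) :=
  𝒩.filter (fun N => i ∈ N ∧ p N i ∉ convexHull ℝ (p N '' ↑(N.erase i)))

/-- Dot product on ℝ^X. -/
def dot {X : Type*} [Fintype X] (a b : X → ℝ) : ℝ := ∑ x, a x * b x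

theorem farkas_aux {ι E : Type*} [AddCommGroup E] [Module ℝ E] (s : Finset ι) :
    ∀ (a : ι → E) (x : E),
      (∃ c : ι → ℝ, (∀ i ∈ s, 0 ≤ c i) ∧ x = ∑ i ∈ s, c i • a i) ∨
      (∃ f : E →ₗ[ℝ] ℝ, (∀ i ∈ s, f (a i) ≤ 0) ∧ 0 < f x) := by
  induction s using Finset.induction_on with
  | empty =>
    intro a x
    by_cases hx : x = 0
    · left; exact ⟨fun _ => 0, by simp, by simp [hx]⟩
    · right
      obtain ⟨f, hf⟩ := Module.Projective.exists_dual_eq_one ℝ hx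
      exact ⟨f, by simp, by rw [hf]; exact one_pos⟩
  | insert k s hk ih =>
    intro a x
    rcases ih a x with ⟨c, hc, hx⟩ | ⟨f, hf, hfx⟩
    · left
      refine ⟨fun i => if i = k then 0 else c i, ?_, ?_⟩
      · intro i hi
        by_cases h : i = k
        · simp [h]
        · simp only [h, if_false]
          exact hc i ((Finset.mem_insert.1 hi).resolve_left h)
      · rw [Finset.sum_insert hk, hx]
        simp only [if_true, zero_smul, zero_add]
        refine Finset.sum_congr rfl fun i hi => ?_
        have : i ≠ k := fun h => hk (h ▸ hi)
        simp [this]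
    · by_cases hfk : f (a k) ≤ 0
      · right
        refine ⟨f, ?_, hfx⟩
        intro i hi
        rcases Finset.mem_insert.1 hi with rfl | h
        · exact hfk
        · exact hf i h
      · push Not at hfk
        rcases ih (fun i => a i - (f (a i) / f (a k)) • a k) (x - (f x / f (a k)) • a k) with
          ⟨c, hc, hx⟩ | ⟨g, hg, hgx⟩
        · left
          refine ⟨fun i => if i = k then f x / f (a k) - ∑ i ∈ s, c i * (f (a i) / f (a k))
            else c i, ?_, ?_⟩
          · intro i hi
            by_cases h : i = k
            · simp only [h, if_true]
              have h1 : 0 ≤ f x / f (a k) := by positivity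
              have h2 : ∑ i ∈ s, c i * (f (a i) / f (a k)) ≤ 0 :=
                Finset.sum_nonpos fun i hi => mul_nonpos_of_nonneg_of_nonpos (hc i hi)
                  (div_nonpos_of_nonpos_of_nonneg (hf i hi) hfk.le)
              linarith
            · simp only [h, if_false]
              exact hc i ((Finset.mem_insert.1 hi).resolve_left h)
          · rw [Finset.sum_insert hk]
            have e : ∑ i ∈ s, (if i = k then f x / f (a k) - ∑ i ∈ s, c i * (f (a i) / f (a k))
                else c i) • a i = ∑ i ∈ s, c i • a i := by
              refine Finset.sum_congr rfl fun i hi => ?_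
              have : i ≠ k := fun h => hk (h ▸ hi)
              simp [this]
            rw [e]
            simp only [if_true, sub_smul, Finset.sum_smul]
            simp only [smul_sub, Finset.sum_sub_distrib, smul_smul] at hx
            rw [sub_eq_iff_eq_add] at hx
            refine hx.trans ?_
            abel
        · right
          refine ⟨g - (g (a k) / f (a k)) • f, ?_, ?_⟩
          · intro i hi
            rcases Finset.mem_insert.1 hi with rfl | h
            · simp [hfk.ne']
            · have := hg i h
              simp only [map_sub, map_smul, smul_eq_mul] at this
              simp only [LinearMap.sub_apply, LinearMap.smul_apply, smul_eq_mul]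
              calc _ = _ := by ring
                _ ≤ 0 := this
          · simp only [map_sub, map_smul, smul_eq_mul] at hgx
            simp only [LinearMap.sub_apply, LinearMap.smul_apply, smul_eq_mul]
            calc _ < _ := hgx
              _ = _ := by ring

theorem hull_weights {A E : Type*} [AddCommGroup E] [Module ℝ E] (s : Finset A) (q : A → E)
    (z : E) (hz : z ∈ convexHull ℝ (q '' (s : Set A))) :
    ∃ w : A → ℝ, (∀ j ∈ s, 0 ≤ w j) ∧ ∑ j ∈ s, w j = 1 ∧ z = ∑ j ∈ s, w j • q j := by
  have hc : Convex ℝ {z : E | ∃ w : A → ℝ, (∀ j ∈ s, 0 ≤ w j) ∧ ∑ j ∈ s, w j = 1 ∧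
      z = ∑ j ∈ s, w j • q j} := by
    rintro _ ⟨w, hw, hw1, rfl⟩ _ ⟨u, hu, hu1, rfl⟩ α β hα hβ hαβ
    refine ⟨fun j => α * w j + β * u j, fun j hj => ?_, ?_, ?_⟩
    · have := hw j hj; have := hu j hj; positivity
    · rw [Finset.sum_add_distrib, ← Finset.mul_sum, ← Finset.mul_sum, hw1, hu1]; linarith
    · simp only [add_smul, Finset.sum_add_distrib, Finset.smul_sum, smul_smul]
  refine convexHull_min ?_ hc hz
  rintro _ ⟨j, hj, rfl⟩
  have hj : j ∈ s := hj
  refine ⟨fun k => if k = j then 1 else 0, fun k _ => by positivity, by simp [hj], by simp [hj]⟩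

theorem dot_add' {X : Type*} [Fintype X] (b u v : X → ℝ) : dot b (u + v) = dot b u + dot b v := by
  simp [dot, mul_add, Finset.sum_add_distrib]

theorem dot_sub' {X : Type*} [Fintype X] (b u v : X → ℝ) : dot b (u - v) = dot b u - dot b v := by
  simp [dot, mul_sub, Finset.sum_sub_distrib]

theorem dot_smul' {X : Type*} [Fintype X] (b u : X → ℝ) (c : ℝ) :
    dot b (c • u) = c * dot b u := by
  simp only [dot, Finset.mul_sum, Pi.smul_apply, smul_eq_mul]
  exact Finset.sum_congr rfl fun _ _ => by ring

theorem dot_sum' {X ι : Type*} [Fintype X] (b : X → ℝ) (s : Finset ι) (u : ι → X → ℝ) :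
    dot b (∑ i ∈ s, u i) = ∑ i ∈ s, dot b (u i) := by
  simp only [dot, Finset.sum_apply, Finset.mul_sum]
  exact Finset.sum_comm

/-- Forward direction for one group. -/
theorem dot_pos_of_rep {X A : Type*} [Fintype X] [DecidableEq A] (N : Finset A) (i : A)
    (hi : i ∈ N) (q : A → X → ℝ) (v : X → ℝ) (w : A → ℝ) (hw : ∀ j ∈ N, 0 ≤ w j)
    (hw1 : ∑ j ∈ N, w j = 1) (hq : q i = w i • v + ∑ j ∈ N.erase i, w j • q j)
    (hext : q i ∉ convexHull ℝ (q '' ↑(N.erase i))) (b : X → ℝ) (hb : 0 < dot b (q i))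
    (hbj : ∀ j ∈ N.erase i, 0 ≤ dot b (q i - q j)) : 0 < dot b v := by
  have hsum : w i + ∑ j ∈ N.erase i, w j = 1 := by rw [Finset.add_sum_erase N w hi, hw1]
  have hpos : 0 < w i := by
    rcases (hw i hi).lt_or_eq with h | h
    · exact h
    · exfalso
      apply hext
      rw [← h, zero_smul, zero_add] at hq
      rw [← h, zero_add] at hsum
      have := (convex_convexHull ℝ (q '' ↑(N.erase i))).sum_mem (t := N.erase i) (w := w) (z := q)
        (fun j hj => hw j (Finset.mem_of_mem_erase hj)) hsum
        (fun j hj => subset_convexHull ℝ _ ⟨j, hj, rfl⟩)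
      rwa [← hq] at this
  have h1 := congrArg (dot b) hq
  rw [dot_add', dot_smul', dot_sum'] at h1
  simp only [dot_smul'] at h1
  have h2 : 0 ≤ ∑ j ∈ N.erase i, w j * dot b (q i - q j) :=
    Finset.sum_nonneg fun j hj => mul_nonneg (hw j (Finset.mem_of_mem_erase hj)) (hbj j hj)
  simp only [dot_sub', mul_sub, Finset.sum_sub_distrib, ← Finset.sum_mul] at h2
  have h3 : 0 < w i * dot b v := by
    have h4 : 0 < w i * dot b (q i) := mul_pos hpos hb
    have h5 : ∑ j ∈ N.erase i, w j = 1 - w i := by linarith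
    rw [h5] at h2
    nlinarith
  exact (mul_pos_iff_of_pos_left hpos).1 h3

theorem lin_eq_dot {X A : Type*} [Fintype X] [DecidableEq A]
    (f : (Finset A → X → ℝ) →ₗ[ℝ] ℝ) (N : Finset A) (u : X → ℝ) :
    f (Pi.single N u) = dot (fun x => f (Pi.single N (Pi.single x 1))) u := by
  have : u = ∑ x, u x • (Pi.single x 1 : X → ℝ) := by
    ext y; simp [Finset.sum_apply, Pi.single_apply]
  conv_lhs => rw [this]
  have h2 := map_sum (f.comp (LinearMap.single ℝ (fun _ : Finset A => X → ℝ) N))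
    (fun x => u x • (Pi.single x 1 : X → ℝ)) Finset.univ
  simp only [map_smul, LinearMap.comp_apply, LinearMap.single_apply, smul_eq_mul] at h2
  refine h2.trans ?_
  exact Finset.sum_congr rfl fun _ _ => mul_comm _ _

theorem exists_v {X A : Type*} [Fintype X] [DecidableEq A] (S : Finset (Finset A))
    (hS : S.Nonempty) (p : Finset A → A → X → ℝ) (i : A) (hi : ∀ N ∈ S, i ∈ N)
    (hp : ∀ N ∈ S, ∀ j ∈ N, p N j ∈ simplex X)
    (hno : ¬ ∃ b : Finset A → X → ℝ,
        (∀ x : X, (∑ N ∈ S, b N x) < 0) ∧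
        (∀ N ∈ S, 0 < dot (b N) (p N i)) ∧
        (∀ N ∈ S, ∀ j ∈ N.erase i, 0 ≤ dot (b N) (p N i - p N j))) :
    ∃ v ∈ simplex X, ∃ c : Finset A → A → ℝ, ∀ N ∈ S, (∀ j ∈ N.erase i, 0 ≤ c N j) ∧
      p N i = v + ∑ j ∈ N.erase i, c N j • (p N j - p N i) := by
  let a : X ⊕ (Σ _ : Finset A, A) → (Finset A → X → ℝ) := fun t =>
    Sum.elim (fun x => ∑ N ∈ S, Pi.single N (Pi.single x 1))
      (fun y => Pi.single y.1 (p y.1 y.2 - p y.1 i)) t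
  rcases farkas_aux (Finset.disjSum Finset.univ (S.sigma fun N => N.erase i)) a
    (∑ N ∈ S, Pi.single N (p N i)) with ⟨c, hc, hx⟩ | ⟨f, hf, hfx⟩
  · have key : ∀ N ∈ S, p N i = (fun x => c (Sum.inl x)) +
        ∑ j ∈ N.erase i, c (Sum.inr ⟨N, j⟩) • (p N j - p N i) := by
      intro N hN
      have h := congrFun hx N
      rw [Finset.sum_disjSum, Finset.sum_sigma] at h
      ext x
      have h := congrFun h x
      simp only [a, Sum.elim_inl, Sum.elim_inr, Finset.sum_apply, Pi.add_apply, Pi.smul_apply] at h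
      have e1 : ∀ u : Finset A → X → ℝ,
          ∑ M ∈ S, (Pi.single M (u M) : Finset A → X → ℝ) N x = u N x := by
        intro u
        rw [Finset.sum_eq_single N]
        · simp
        · intro M _ hM
          simp [Pi.single_eq_of_ne (Ne.symm hM)]
        · exact fun h => absurd hN h
      rw [e1 (fun M => p M i)] at h
      simp only [e1 (fun _ => Pi.single _ 1)] at h
      rw [Finset.sum_eq_single (a := N) (s := S)] at h
      · rw [h]
        simp [Finset.sum_apply, Pi.single_apply]
      · intro M _ hM
        simp [Pi.single_eq_of_ne (Ne.symm hM)]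
      · exact fun h => absurd hN h
    refine ⟨fun x => c (Sum.inl x), ⟨fun x => hc _ (by simp), ?_⟩,
      fun N j => c (Sum.inr ⟨N, j⟩), fun N hN => ⟨fun j hj => hc _ ?_, key N hN⟩⟩
    · obtain ⟨N, hN⟩ := hS
      have h := congrArg (fun u : X → ℝ => ∑ x, u x) (key N hN)
      simp only [Pi.add_apply, Finset.sum_add_distrib, Finset.sum_apply, Pi.smul_apply,
        Pi.sub_apply, smul_eq_mul] at h
      rw [(hp N hN i (hi N hN)).2, Finset.sum_comm] at h
      rw [Finset.sum_eq_zero (s := N.erase i)] at h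
      · linarith
      · intro j hj
        rw [← Finset.mul_sum, Finset.sum_sub_distrib, (hp N hN i (hi N hN)).2,
          (hp N hN j (Finset.mem_of_mem_erase hj)).2]
        simp
    · rw [Finset.inr_mem_disjSum, Finset.mem_sigma]
      exact ⟨hN, hj⟩
  · exfalso
    apply hno
    let b0 : Finset A → X → ℝ := fun N x => f (Pi.single N (Pi.single x 1))
    have hb0 : ∀ N u, f (Pi.single N u) = dot (b0 N) u := fun N u => lin_eq_dot f N u
    rw [map_sum] at hfx
    simp only [hb0] at hfx
    obtain ⟨T, hT⟩ : ∃ T, T = ∑ N ∈ S, dot (b0 N) (p N i) := ⟨_, rfl⟩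
    rw [← hT] at hfx
    obtain ⟨K, hKd⟩ : ∃ K : ℝ, K = (S.card : ℝ) := ⟨_, rfl⟩
    have hK : 0 < K := by rw [hKd]; exact_mod_cast hS.card_pos
    let k : Finset A → ℝ := fun N => T / (2 * K) - dot (b0 N) (p N i)
    have hd : ∀ N (u : X → ℝ), dot (fun x => b0 N x + k N) u = dot (b0 N) u + k N * ∑ x, u x := by
      intro N u
      simp [dot, add_mul, Finset.sum_add_distrib, Finset.mul_sum]
    refine ⟨fun N x => b0 N x + k N, ?_, ?_, ?_⟩
    · intro x
      have h := hf (Sum.inl x) (by simp)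
      simp only [a, Sum.elim_inl, map_sum] at h
      have h' : ∑ N ∈ S, b0 N x ≤ 0 := h
      have hk : ∑ N ∈ S, k N = - (T / 2) := by
        simp only [k, Finset.sum_sub_distrib, Finset.sum_const, nsmul_eq_mul, ← hT, ← hKd]
        have hK2 : K * (T / (2 * K)) = T / 2 := by
          rw [mul_div_assoc', mul_comm 2 K, mul_div_mul_left _ _ hK.ne']
        linarith
      rw [Finset.sum_add_distrib, hk]
      linarith
    · intro N hN
      rw [hd, (hp N hN i (hi N hN)).2]
      have : 0 < T / (2 * K) := div_pos hfx (mul_pos two_pos hK)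
      simp only [k]
      linarith
    · intro N hN j hj
      rw [hd]
      have h := hf (Sum.inr ⟨N, j⟩) (by
        rw [Finset.inr_mem_disjSum, Finset.mem_sigma]; exact ⟨hN, hj⟩)
      simp only [a, Sum.elim_inr, hb0, dot_sub'] at h
      simp only [Pi.sub_apply, Finset.sum_sub_distrib, (hp N hN i (hi N hN)).2,
          (hp N hN j (Finset.mem_of_mem_erase hj)).2, dot_sub']
      linarith

/-- Theorem C.1, (1) ⇔ (3): consistency with GLM* is equivalent to the absence of ext
incentive compatible money pumps. -/
theorem glmstar_iff_no_ext_incentive_compatible_money_pump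
    {X A : Type*} [Fintype X] [Fintype A] [DecidableEq A]
    (hX : 2 ≤ Fintype.card X) (hA : 2 ≤ Fintype.card A)
    (𝒩 : Finset (Finset A)) (h𝒩 : 𝒩.Nonempty) (h𝒩' : ∀ N ∈ 𝒩, N.Nonempty)
    (p : Finset A → A → X → ℝ) (hp : ∀ N ∈ 𝒩, ∀ i ∈ N, p N i ∈ simplex X) :
    GLMStarConsistent 𝒩 p ↔
      ∀ i : A, ¬ ∃ b : Finset A → X → ℝ,
        (∀ x : X, (∑ N ∈ Next 𝒩 p i, b N x) < 0) ∧
        (∀ N ∈ Next 𝒩 p i, 0 < dot (b N) (p N i)) ∧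
        (∀ N ∈ Next 𝒩 p i, ∀ j ∈ N.erase i,
          0 ≤ dot (b N) (p N i - p N j)) := by
  have hXne : Nonempty X := Fintype.card_pos_iff.1 (by omega)
  constructor
  · rintro ⟨v, hv, hrep⟩ i ⟨b, hb1, hb2, hb3⟩
    have hpos : ∀ N ∈ Next 𝒩 p i, 0 < dot (b N) (v i) := by
      intro N hN
      obtain ⟨hN1, hN2, hN3⟩ := Finset.mem_filter.1 hN
      obtain ⟨w, hw, hw1, hq⟩ := hrep N hN1 i hN2
      exact dot_pos_of_rep N i hN2 (p N) (v i) w hw hw1 hq hN3 (b N) (hb2 N hN) (hb3 N hN)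
    have h0 : 0 ≤ ∑ N ∈ Next 𝒩 p i, dot (b N) (v i) :=
      Finset.sum_nonneg fun N hN => (hpos N hN).le
    have h1 : ∑ N ∈ Next 𝒩 p i, dot (b N) (v i) =
        ∑ x, (∑ N ∈ Next 𝒩 p i, b N x) * v i x := by
      simp only [dot, Finset.sum_mul]
      exact Finset.sum_comm
    rw [h1] at h0
    have hz : ∃ x, 0 < v i x := by
      by_contra hcon
      push Not at hcon
      have := Finset.sum_nonpos (s := Finset.univ) fun x _ => hcon x
      rw [(hv i).2] at this
      linarith
    obtain ⟨x, hx⟩ := hz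
    have h2 : ∑ x, (∑ N ∈ Next 𝒩 p i, b N x) * v i x < 0 := by
      refine Finset.sum_neg' ?_ ⟨x, Finset.mem_univ x, ?_⟩
      · intro y _
        exact mul_nonpos_of_nonpos_of_nonneg (hb1 y).le ((hv i).1 y)
      · exact mul_neg_of_neg_of_pos (hb1 x) hx
    linarith
  · intro hno
    have hmain : ∀ i, ∃ v ∈ simplex X, ∀ N ∈ 𝒩, i ∈ N → ∃ π : A → ℝ,
      (∀ j ∈ N, 0 ≤ π j) ∧ (∑ j ∈ N, π j) = 1 ∧
      p N i = π i • v + ∑ j ∈ N.erase i, π j • p N j := by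
      intro i
      have hex : ∃ v ∈ simplex X, ∃ c : Finset A → A → ℝ, ∀ N ∈ Next 𝒩 p i,
          (∀ j ∈ N.erase i, 0 ≤ c N j) ∧
          p N i = v + ∑ j ∈ N.erase i, c N j • (p N j - p N i) := by
        by_cases hS : (Next 𝒩 p i).Nonempty
        · exact exists_v (Next 𝒩 p i) hS p i (fun N hN => (Finset.mem_filter.1 hN).2.1)
            (fun N hN => hp N (Finset.mem_filter.1 hN).1) (hno i)
        · obtain ⟨N, hN⟩ := h𝒩
          obtain ⟨j, hj⟩ := h𝒩' N hN
          refine ⟨p N j, hp N hN j hj, fun _ _ => 0, fun M hM => absurd ⟨M, hM⟩ hS⟩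
      obtain ⟨v, hv, c, hc⟩ := hex
      refine ⟨v, hv, fun N hN hi => ?_⟩
      by_cases hE : p N i ∈ convexHull ℝ (p N '' ↑(N.erase i))
      · obtain ⟨w, hw, hw1, hq⟩ := hull_weights _ _ _ hE
        refine ⟨fun j => if j = i then 0 else w j, ?_, ?_, ?_⟩
        · intro j hj
          by_cases h : j = i
          · simp [h]
          · simp only [h, if_false]
            exact hw j (Finset.mem_erase.2 ⟨h, hj⟩)
        · rw [← Finset.add_sum_erase N _ hi, ← hw1]
          simp only [if_true, zero_add]
          exact Finset.sum_congr rfl fun j hj => if_neg (Finset.ne_of_mem_erase hj)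
        · simp only [if_true, zero_smul, zero_add]
          refine hq.trans ?_
          exact Finset.sum_congr rfl fun j hj => by rw [if_neg (Finset.ne_of_mem_erase hj)]
      · obtain ⟨hc0, hq⟩ := hc N (Finset.mem_filter.2 ⟨hN, hi, hE⟩)
        set C := ∑ j ∈ N.erase i, c N j with hC
        have hCpos : 0 < 1 + C := by
          have : 0 ≤ C := Finset.sum_nonneg hc0
          linarith
        refine ⟨fun j => if j = i then 1 / (1 + C) else c N j / (1 + C), ?_, ?_, ?_⟩
        · intro j hj
          by_cases h : j = i
          · simp only [h, if_true]; positivity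
          · simp only [h, if_false]
            exact div_nonneg (hc0 j (Finset.mem_erase.2 ⟨h, hj⟩)) hCpos.le
        · rw [← Finset.add_sum_erase N _ hi]
          rw [Finset.sum_congr rfl fun j hj => if_neg (Finset.ne_of_mem_erase hj)]
          rw [← Finset.sum_div, ← hC]
          simp only [if_true]
          field_simp
        · have e : ∑ j ∈ N.erase i, (if j = i then 1 / (1 + C) else c N j / (1 + C)) • p N j =
              ∑ j ∈ N.erase i, (c N j / (1 + C)) • p N j :=
            Finset.sum_congr rfl fun j hj => by rw [if_neg (Finset.ne_of_mem_erase hj)]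
          simp only [if_true]
          rw [e]
          ext x
          have h := congrFun hq x
          simp only [Pi.add_apply, Finset.sum_apply, Pi.smul_apply, Pi.sub_apply, smul_eq_mul,
            mul_sub, Finset.sum_sub_distrib, ← Finset.sum_mul, ← hC] at h
          simp only [Pi.add_apply, Finset.sum_apply, Pi.smul_apply, smul_eq_mul, div_mul_eq_mul_div,
            ← Finset.sum_div]
          rw [← add_div, eq_div_iff hCpos.ne']
          linarith
    choose v hv hrep using hmain
    exact ⟨v, hv, fun N hN i hi => hrep i N hN hi⟩
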